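/- Let f : ℂ → ℂ be an entire function satisfying the quasi-periodicity equation f(z+m) = e^{2πiαm} e^{ν(z+m/2)m} f(z) for all z ∈ ℂ and all m ∈ ℤ. Then there exists a unique sequence (aₙ)_{n∈ℤ} of complex numbers such that f(z) = Σ_{n∈ℤ} aₙ e^{(ν/2)z² + 2πi(α+n)z} for all z ∈ ℂ, the series converging absolutely and uniformly on compact subsets of ℂ. -/

import Mathlib

open Complex

/-- The restriction of a `1`-periodic continuous function on `ℂ` to the horizontal line of height
`y`, as a continuous function on the unit circle. -/
noncomputable def horizontalSlice (g : ℂ → ℂ) (hg : Continuous g)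
    (hp : ∀ z, g (z + 1) = g z) (y : ℝ) : C(UnitAddCircle, ℂ) where
  toFun := Function.Periodic.lift (f := fun x : ℝ => g (x + y * I)) (c := 1) fun x => by
    simpa [add_right_comm] using hp (x + y * I)
  continuous_toFun := by
    refine continuous_coinduced_dom.mpr ?_
    change Continuous fun x : ℝ => g (x + y * I)
    fun_prop

theorem horizontalSlice_coe (g : ℂ → ℂ) (hg : Continuous g) (hp : ∀ z, g (z + 1) = g z)
    (y x : ℝ) : horizontalSlice g hg hp y (x : UnitAddCircle) = g (x + y * I) :=
  rfl

theorem norm_fourierCoeff_le {T : ℝ} [Fact (0 < T)] (F : C(AddCircle T, ℂ)) (n : ℤ) :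
    ‖fourierCoeff F n‖ ≤ ‖F‖ := by
  have h : ∀ t : AddCircle T, ‖fourier (-n) t • F t‖ ≤ ‖F‖ := fun t => by
    rw [norm_smul, fourier_apply, Circle.norm_coe, one_mul]
    exact F.norm_coe_le_norm t
  simpa [fourierCoeff] using
    MeasureTheory.norm_integral_le_of_norm_le_const (μ := AddCircle.haarAddCircle)
      (Filter.Eventually.of_forall h)

/-- The coefficients of an absolutely convergent trigonometric series are the Fourier coefficients
of its sum. -/
theorem fourierCoeff_eq_of_hasSum {T : ℝ} [Fact (0 < T)] {a : ℤ → ℂ} {F : AddCircle T → ℂ}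
    (ha : Summable fun n => ‖a n‖) (hF : ∀ x, HasSum (fun n => a n * fourier n x) (F x)) :
    fourierCoeff F = a := by
  ext m
  have hnorm : ∀ n (t : AddCircle T), ‖fourier (-m) t • (a n * fourier n t)‖ = ‖a n‖ := by
    intro n t
    simp only [norm_smul, norm_mul, fourier_apply, Circle.norm_coe, one_mul, mul_one]
  have key := MeasureTheory.hasSum_integral_of_summable_integral_norm
    (μ := AddCircle.haarAddCircle (T := T))
    (F := fun n t => fourier (-m) t • (a n * fourier n t))
    (fun n => Continuous.integrable_of_hasCompactSupport (by fun_prop)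
      (HasCompactSupport.of_compactSpace _))
    (by simp only [hnorm]; simpa using ha)
  have hterm : ∀ n, ∫ t : AddCircle T, fourier (-m) t • (a n * fourier n t)
      ∂AddCircle.haarAddCircle = Pi.single (M := fun _ => ℂ) m (a m) n := by
    intro n
    have h := fourierCoeff.const_mul (fun t : AddCircle T => fourier n t) (a n) m
    rw [fourierCoeff] at h
    rw [h, fourierCoeff_fourier]
    obtain rfl | hne := eq_or_ne m n
    · simp
    · simp [hne, hne.symm]
  simp only [hterm] at key
  rw [fourierCoeff, (hasSum_pi_single m (a m)).unique key]
  refine MeasureTheory.integral_congr_ae (Filter.Eventually.of_forall fun t => ?_)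
  exact ((hF t).const_smul (fourier (-m) t)).tsum_eq.symm

theorem fourierCoeff_horizontalSlice (g : ℂ → ℂ) (hg : Continuous g)
    (hp : ∀ z, g (z + 1) = g z) (y : ℝ) (n : ℤ) :
    fourierCoeff (horizontalSlice g hg hp y) n = exp (-(2 * Real.pi * n * y)) *
      ∫ x in (0 : ℝ)..1, exp (-(2 * Real.pi * I * n * (x + y * I))) * g (x + y * I) := by
  rw [fourierCoeff_eq_intervalIntegral _ _ 0, ← intervalIntegral.integral_const_mul]
  simp only [zero_add, div_one, one_smul, fourier_coe_apply, horizontalSlice_coe, smul_eq_mul]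
  refine intervalIntegral.integral_congr fun x _ => ?_
  simp only [← mul_assoc, ← Complex.exp_add]
  congr 2
  push_cast
  linear_combination (2 * Real.pi * n * y : ℂ) * I_sq

/-- Integrals of a `1`-periodic entire function over a period do not depend on the height. -/
theorem intervalIntegral_add_mul_I_of_periodic {h : ℂ → ℂ} (hd : Differentiable ℂ h)
    (hp : ∀ z, h (z + 1) = h z) (y : ℝ) :
    ∫ x in (0 : ℝ)..1, h (x + y * I) = ∫ x in (0 : ℝ)..1, h x := by
  have key := integral_boundary_rect_eq_zero_of_differentiableOn h 0 (1 + y * I)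
    hd.differentiableOn
  have hside : ∀ t : ℝ, h (1 + t * I) = h (t * I) := fun t => by rw [add_comm, hp]
  simp [hside] at key
  exact (sub_eq_zero.mp key).symm

theorem fourierCoeff_horizontalSlice_eq (g : ℂ → ℂ) (hg : Differentiable ℂ g)
    (hp : ∀ z, g (z + 1) = g z) (y : ℝ) (n : ℤ) :
    fourierCoeff (horizontalSlice g hg.continuous hp y) n = exp (-(2 * Real.pi * n * y)) *
      fourierCoeff (horizontalSlice g hg.continuous hp 0) n := by
  have hper : ∀ z : ℂ, exp (-(2 * Real.pi * I * n * (z + 1))) * g (z + 1) =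
      exp (-(2 * Real.pi * I * n * z)) * g z := by
    intro z
    rw [hp, show -(2 * Real.pi * I * n * (z + 1)) =
      -(2 * Real.pi * I * n * z) + (-n : ℤ) * (2 * Real.pi * I) by push_cast; ring,
      Complex.exp_add, exp_int_mul_two_pi_mul_I, mul_one]
  have hd : Differentiable ℂ fun z => exp (-(2 * Real.pi * I * n * z)) * g z := by fun_prop
  rw [fourierCoeff_horizontalSlice, fourierCoeff_horizontalSlice,
    intervalIntegral_add_mul_I_of_periodic hd hper y]
  simp

/-- Fourier expansion of a `1`-periodic entire function: the coefficients decay faster than any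
exponential. -/
theorem exists_fourier_expansion_of_periodic {g : ℂ → ℂ} (hg : Differentiable ℂ g)
    (hp : ∀ z, g (z + 1) = g z) :
    ∃ c : ℤ → ℂ, (∀ r : ℝ, Summable fun n : ℤ => ‖c n‖ * Real.exp (2 * Real.pi * r * |(n : ℝ)|)) ∧
      ∀ z, HasSum (fun n : ℤ => c n * exp (2 * Real.pi * I * n * z)) (g z) := by
  set G := horizontalSlice g hg.continuous hp with hG
  set c := fourierCoeff (G 0)
  have hcoeff : ∀ y n, fourierCoeff (G y) n = exp (-(2 * Real.pi * n * y)) * c n :=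
    fourierCoeff_horizontalSlice_eq g hg hp
  have hnorm : ∀ (y : ℝ) (n : ℤ),
      ‖fourierCoeff (G y) n‖ = Real.exp (-(2 * Real.pi * n * y)) * ‖c n‖ := by
    intro y n
    rw [hcoeff, norm_mul, Complex.norm_exp]
    congr 2
    simp
  have hbound : ∀ (R : ℝ) (n : ℤ),
      ‖c n‖ * Real.exp (2 * Real.pi * R * |(n : ℝ)|) ≤ ‖G R‖ + ‖G (-R)‖ := by
    intro R n
    rcases abs_cases (n : ℝ) with ⟨h, -⟩ | ⟨h, -⟩
    · have := (hnorm (-R) n).symm.trans_le (norm_fourierCoeff_le (G (-R)) n)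
      rw [h, mul_comm, show 2 * Real.pi * R * (n : ℝ) = -(2 * Real.pi * n * -R) by ring]
      linarith [norm_nonneg (G R)]
    · have := (hnorm R n).symm.trans_le (norm_fourierCoeff_le (G R) n)
      rw [h, mul_comm, show 2 * Real.pi * R * -(n : ℝ) = -(2 * Real.pi * n * R) by ring]
      linarith [norm_nonneg (G (-R))]
  have hgeom : Summable fun n : ℤ => Real.exp (-(2 * Real.pi * |(n : ℝ)|)) := by
    have hnat : Summable fun n : ℕ => Real.exp (-(2 * Real.pi * (n : ℝ))) := by
      have := Real.summable_exp_nat_mul_iff.mpr (neg_neg_of_pos Real.two_pi_pos)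
      exact this.congr fun n => by congr 1; ring
    refine Summable.of_nat_of_neg ?_ ?_ <;> simpa using hnat
  have hsum : ∀ r : ℝ, Summable fun n : ℤ =>
      ‖c n‖ * Real.exp (2 * Real.pi * r * |(n : ℝ)|) := by
    intro r
    refine Summable.of_nonneg_of_le (fun n => by positivity) (fun n => ?_)
      (hgeom.mul_left (‖G (r + 1)‖ + ‖G (-(r + 1))‖))
    calc ‖c n‖ * Real.exp (2 * Real.pi * r * |(n : ℝ)|)
        = ‖c n‖ * Real.exp (2 * Real.pi * (r + 1) * |(n : ℝ)|) *
            Real.exp (-(2 * Real.pi * |(n : ℝ)|)) := by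
          rw [mul_assoc ‖c n‖, ← Real.exp_add]
          ring_nf
      _ ≤ _ := by gcongr; exact hbound _ _
  refine ⟨c, hsum, fun z => ?_⟩
  have hs : Summable (fourierCoeff (G z.im)) := by
    refine .of_norm_bounded (hsum |z.im|) fun n => ?_
    rw [hnorm, mul_comm]
    gcongr
    calc -(2 * Real.pi * n * z.im) = 2 * Real.pi * -(n * z.im) := by ring
      _ ≤ 2 * Real.pi * |(n : ℝ) * z.im| := by gcongr; exact neg_le_abs _
      _ = _ := by rw [abs_mul]; ring
  have := has_pointwise_sum_fourier_series_of_summable hs (z.re : UnitAddCircle)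
  rw [hG, horizontalSlice_coe, re_add_im, ← hG] at this
  refine this.congr_fun fun n => ?_
  rw [hcoeff, fourier_coe_apply, smul_eq_mul, mul_comm (exp _) (c n), mul_assoc (c n), ← Complex.exp_add]
  congr 2
  conv_lhs => rw [← re_add_im z]
  push_cast
  linear_combination (2 * Real.pi * n * z.im : ℂ) * I_sq

theorem norm_exp_two_pi_mul_I_le {z : ℂ} {r : ℝ} (hz : ‖z‖ ≤ r) (n : ℤ) :
    ‖exp (2 * Real.pi * I * n * z)‖ ≤ Real.exp (2 * Real.pi * r * |(n : ℝ)|) := by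
  refine (norm_exp_le_exp_norm _).trans (Real.exp_le_exp.mpr ?_)
  have : ‖2 * Real.pi * I * n * z‖ = 2 * Real.pi * |(n : ℝ)| * ‖z‖ := by
    simp [abs_of_pos Real.pi_pos]
  rw [this, mul_right_comm]
  gcongr

/-- An entire quasi-periodic function `f` has a unique expansion
`f(z) = Σ_{n∈ℤ} aₙ e^{(ν/2)z² + 2πi(α+n)z}`, the series converging absolutely and
uniformly on compact subsets of `ℂ`. -/
theorem stmt_1 (α ν : ℝ) (hν : 0 < ν) (f : ℂ → ℂ) (hf : Differentiable ℂ f)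
    (hqp : ∀ (z : ℂ) (m : ℤ), f (z + m) =
        Complex.exp (2 * Real.pi * Complex.I * α * m) *
          Complex.exp (ν * (z + m / 2) * m) * f z) :
    ∃! a : ℤ → ℂ,
      (∀ z : ℂ, Summable fun n : ℤ =>
          ‖a n * Complex.exp (ν / 2 * z ^ 2 + 2 * Real.pi * Complex.I * (α + n) * z)‖) ∧
      (∀ K : Set ℂ, IsCompact K →
        TendstoUniformlyOn
          (fun (s : Finset ℤ) (z : ℂ) =>
            ∑ n ∈ s, a n * Complex.exp (ν / 2 * z ^ 2 + 2 * Real.pi * Complex.I * (α + n) * z))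
          f Filter.atTop K) ∧
      (∀ z : ℂ, f z =
        ∑' n : ℤ, a n * Complex.exp (ν / 2 * z ^ 2 + 2 * Real.pi * Complex.I * (α + n) * z)) := by
  set E : ℂ → ℂ := fun z => exp (ν / 2 * z ^ 2 + 2 * Real.pi * I * α * z) with hE
  have hEd : Differentiable ℂ E := by fun_prop
  have hE0 : ∀ z, E z ≠ 0 := fun z => exp_ne_zero _
  have hsplit : ∀ (n : ℤ) (z : ℂ), exp (ν / 2 * z ^ 2 + 2 * Real.pi * I * (α + n) * z) =
      E z * exp (2 * Real.pi * I * n * z) := by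
    intro n z
    rw [hE, ← Complex.exp_add]
    ring_nf
  have hmul : ∀ (b : ℂ) (n : ℤ) (z : ℂ),
      b * exp (ν / 2 * z ^ 2 + 2 * Real.pi * I * (α + n) * z) =
        E z * (b * exp (2 * Real.pi * I * n * z)) := by
    intro b n z
    rw [hsplit, mul_left_comm]
  have hgd : Differentiable ℂ fun z => f z / E z := hf.div hEd hE0
  have hgp : ∀ z, f (z + 1) / E (z + 1) = f z / E z := by
    intro z
    have h1 := hqp z 1
    have h2 : E (z + 1) = exp (2 * Real.pi * I * α) * exp (ν * (z + 1 / 2)) * E z := by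
      simp only [hE, ← Complex.exp_add]
      ring_nf
    simp only [Int.cast_one, mul_one] at h1
    rw [h1, h2, mul_div_mul_left _ _ (mul_ne_zero (exp_ne_zero _) (exp_ne_zero _))]
  obtain ⟨c, hc, hsum⟩ := exists_fourier_expansion_of_periodic hgd hgp
  have hf_sum : ∀ z, HasSum
      (fun n : ℤ => c n * exp (ν / 2 * z ^ 2 + 2 * Real.pi * I * (α + n) * z)) (f z) := by
    intro z
    simp only [hmul]
    simpa [mul_div_cancel₀ _ (hE0 z)] using (hsum z).mul_left (E z)
  refine ⟨c, ⟨fun z => (hf_sum z).summable.norm, fun K hK => ?_,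
    fun z => (hf_sum z).tsum_eq.symm⟩, ?_⟩
  · obtain ⟨r, hr⟩ := hK.isBounded.exists_norm_le
    obtain ⟨M, hM⟩ := hK.exists_bound_of_continuousOn hEd.continuous.continuousOn
    have hlim := tendstoUniformlyOn_tsum (s := K)
      (f := fun (n : ℤ) z => c n * exp (ν / 2 * z ^ 2 + 2 * Real.pi * I * (α + n) * z))
      ((hc r).mul_left M) fun n z hz => by
        rw [hmul, norm_mul, norm_mul]
        have hM0 : 0 ≤ M := (norm_nonneg _).trans (hM z hz)
        gcongr
        · exact hM z hz
        · exact norm_exp_two_pi_mul_I_le (hr z hz) n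
    exact hlim.congr_right fun z _ => (hf_sum z).tsum_eq
  · rintro a ⟨ha, -, haf⟩
    have hcoeff : ∀ b : ℤ → ℂ,
        (∀ z, HasSum (fun n : ℤ => b n * exp (ν / 2 * z ^ 2 + 2 * Real.pi * I * (α + n) * z))
          (f z)) →
        b = fourierCoeff
          (horizontalSlice (fun z => f z / E z) hgd.continuous hgp 0) := by
      intro b hb
      refine (fourierCoeff_eq_of_hasSum ?_ fun t => ?_).symm
      · simpa using (hb 0).summable.norm
      · induction t using QuotientAddGroup.induction_on with | _ x
        simp only [horizontalSlice_coe, fourier_coe_apply]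
        simp only [hmul] at hb
        simpa [hE0, mul_div_cancel_left₀] using
          (hb x).div_const (E x)
    rw [hcoeff a fun z => haf z ▸ (ha z).of_norm.hasSum, ← hcoeff c hf_sum]
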